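/- Let χ > 0, assume (B) and (init), let (u, v) be the maximal classical solution of the crime model on Ω̄ × [0, T_max), and let r ∈ (1,3). Then for each T > 0 there exists C(T) > 0 such that, with T̂_max := min{T, T_max} and τ := min{1, T_max/3}, ∫_t^{t+τ} ∫_Ω v^r ≤ C(T) for all t ∈ (0, T̂_max − τ), and sup_{T>0} C(T) < ∞ if either hypothesis (H1) or hypothesis (H2) holds. -/

import Mathlib

open Real MeasureTheory Filter Topology Set
open scoped ENNReal NNReal

noncomputable section

/-- Partial derivative of a space-time function in the first (space) variable. -/
def pdx (f : ℝ → ℝ → ℝ) : ℝ → ℝ → ℝ := fun x t => deriv (fun y => f y t) x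

/-- Partial derivative of a space-time function in the second (time) variable. -/
def pdt (f : ℝ → ℝ → ℝ) : ℝ → ℝ → ℝ := fun x t => deriv (fun s => f x s) t

/-- The time interval `[0, Tmax)` (with `Tmax ∈ (0,∞]`). -/
def It (Tmax : ℝ≥0∞) : Set ℝ := {t : ℝ | 0 ≤ t ∧ ENNReal.ofReal t < Tmax}

/-- The time interval `(0, Tmax)` (with `Tmax ∈ (0,∞]`). -/
def It' (Tmax : ℝ≥0∞) : Set ℝ := {t : ℝ | 0 < t ∧ ENNReal.ofReal t < Tmax}

/-- The waiting time `τ := min{1, Tmax/3}`, as a real number. -/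
def tauOf (Tmax : ℝ≥0∞) : ℝ := (min 1 (Tmax / 3)).toReal

/-- Hypothesis (B): `B` is nonnegative, bounded, and locally Hölder continuous on
`Ω̄ × [0,∞)` with some exponent `ϑ ∈ (0,1)`. -/
def HypB (a b : ℝ) (B : ℝ → ℝ → ℝ) : Prop :=
  (∀ x t : ℝ, 0 ≤ B x t) ∧ (∃ M : ℝ, ∀ x t : ℝ, B x t ≤ M) ∧
  ∃ ϑ : ℝ, ϑ ∈ Set.Ioo (0:ℝ) 1 ∧
    ∀ K : Set (ℝ × ℝ), IsCompact K → K ⊆ (Set.Icc a b) ×ˢ (Set.Ici (0:ℝ)) →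
      ∃ C : ℝ, ∀ p ∈ K, ∀ q ∈ K, |B p.1 p.2 - B q.1 q.2| ≤ C * dist p q ^ ϑ

/-- Hypothesis (init): `u0 ∈ C⁰(Ω̄)` nonnegative, `v0 ∈ W^{1,∞}(Ω)` (i.e. Lipschitz)
positive on `Ω̄`. -/
def HypInit (a b : ℝ) (u0 v0 : ℝ → ℝ) : Prop :=
  ContinuousOn u0 (Set.Icc a b) ∧ (∀ x ∈ Set.Icc a b, 0 ≤ u0 x) ∧
  (∃ L : ℝ≥0, LipschitzOnWith L v0 (Set.Icc a b)) ∧ (∀ x ∈ Set.Icc a b, 0 < v0 x)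

/-- Hypothesis (H1): `∫_0^∞ ∫_Ω B1 < ∞`. -/
def HypH1 (a b : ℝ) (B1 : ℝ → ℝ → ℝ) : Prop :=
  MeasureTheory.IntegrableOn (fun p : ℝ × ℝ => B1 p.1 p.2)
    ((Set.Ioo a b) ×ˢ (Set.Ioi (0:ℝ)))

/-- Hypothesis (H1'): `∫_t^{t+1} ∫_Ω B1 → 0` as `t → ∞`. -/
def HypH1' (a b : ℝ) (B1 : ℝ → ℝ → ℝ) : Prop :=
  Filter.Tendsto (fun t : ℝ => ∫ s in t..(t+1), ∫ x in Set.Ioo a b, B1 x s)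
    Filter.atTop (nhds 0)

/-- Hypothesis (H2): `inf_{t>0} ∫_Ω B2(·,t) > 0`. -/
def HypH2 (a b : ℝ) (B2 : ℝ → ℝ → ℝ) : Prop :=
  ∃ c : ℝ, 0 < c ∧ ∀ t : ℝ, 0 < t → c ≤ ∫ x in Set.Ioo a b, B2 x t

/-- Hypothesis (H3): `B2(·,t)` stabilizes to `B2inf ∈ L²(Ω)` in the averaged `L²` sense. -/
def HypH3 (a b : ℝ) (B2 : ℝ → ℝ → ℝ) (B2inf : ℝ → ℝ) : Prop :=
  MeasureTheory.MemLp B2inf 2 (MeasureTheory.volume.restrict (Set.Ioo a b)) ∧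
  Filter.Tendsto
    (fun t : ℝ => ∫ s in t..(t+1), ∫ x in Set.Ioo a b, (B2 x s - B2inf x)^2)
    Filter.atTop (nhds 0)

/-- A classical solution of the urban crime system
`u_t = u_xx − χ (u/v · v_x)_x − uv + B1`, `v_t = v_xx + uv − v + B2` on
`Ω̄ × [0, Tmax)`, `Ω = (a,b)`, with homogeneous Neumann boundary conditions and
initial data `(u0, v0)`; `u, v` are positive on `Ω̄ × (0, Tmax)`, belong to
`C⁰(Ω̄ × [0,Tmax)) ∩ C^{2,1}(Ω̄ × (0,Tmax))` and `v(·,t)` lies in `W^{1,r}(Ω)`,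
continuously in `t`, for every `r > 1`. -/
structure CrimeSol (a b χ : ℝ) (B1 B2 : ℝ → ℝ → ℝ) (u0 v0 : ℝ → ℝ)
    (u v : ℝ → ℝ → ℝ) (Tmax : ℝ≥0∞) : Prop where
  u_cont : ContinuousOn (fun p : ℝ × ℝ => u p.1 p.2) ((Set.Icc a b) ×ˢ It Tmax)
  v_cont : ContinuousOn (fun p : ℝ × ℝ => v p.1 p.2) ((Set.Icc a b) ×ˢ It Tmax)
  u_init : ∀ x ∈ Set.Icc a b, u x 0 = u0 x
  v_init : ∀ x ∈ Set.Icc a b, v x 0 = v0 x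
  u_pos : ∀ x ∈ Set.Icc a b, ∀ t ∈ It' Tmax, 0 < u x t
  v_pos : ∀ x ∈ Set.Icc a b, ∀ t ∈ It' Tmax, 0 < v x t
  u_reg : ∀ x ∈ Set.Icc a b, ∀ t ∈ It' Tmax,
    DifferentiableAt ℝ (fun y => u y t) x ∧
    DifferentiableAt ℝ (fun y => pdx u y t) x ∧
    DifferentiableAt ℝ (fun s => u x s) t
  v_reg : ∀ x ∈ Set.Icc a b, ∀ t ∈ It' Tmax,
    DifferentiableAt ℝ (fun y => v y t) x ∧
    DifferentiableAt ℝ (fun y => pdx v y t) x ∧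
    DifferentiableAt ℝ (fun s => v x s) t
  u_cont21 : ContinuousOn
    (fun p : ℝ × ℝ => (pdx u p.1 p.2, pdx (pdx u) p.1 p.2, pdt u p.1 p.2))
    ((Set.Icc a b) ×ˢ It' Tmax)
  v_cont21 : ContinuousOn
    (fun p : ℝ × ℝ => (pdx v p.1 p.2, pdx (pdx v) p.1 p.2, pdt v p.1 p.2))
    ((Set.Icc a b) ×ˢ It' Tmax)
  v_W1r : ∀ r : ℝ, 1 < r →
    (∀ t ∈ It Tmax,
      MeasureTheory.IntegrableOn (fun x => |pdx v x t| ^ r) (Set.Ioo a b)) ∧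
    ContinuousOn (fun t => ∫ x in Set.Ioo a b, |pdx v x t| ^ r) (It Tmax)
  u_eq : ∀ x ∈ Set.Ioo a b, ∀ t ∈ It' Tmax,
    pdt u x t = pdx (pdx u) x t
      - χ * pdx (fun y s => u y s / v y s * pdx v y s) x t
      - u x t * v x t + B1 x t
  v_eq : ∀ x ∈ Set.Ioo a b, ∀ t ∈ It' Tmax,
    pdt v x t = pdx (pdx v) x t + u x t * v x t - v x t + B2 x t
  u_bc : ∀ t ∈ It' Tmax, pdx u a t = 0 ∧ pdx u b t = 0
  v_bc : ∀ t ∈ It' Tmax, pdx v a t = 0 ∧ pdx v b t = 0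

/-- A classical solution of the stationary Neumann problem
`−w'' + w = B` in `Ω = (a,b)`, `w' = 0` on `∂Ω`. -/
def IsStationarySol (a b : ℝ) (B : ℝ → ℝ) (w : ℝ → ℝ) : Prop :=
  ContinuousOn w (Set.Icc a b) ∧
  (∀ x ∈ Set.Icc a b, DifferentiableAt ℝ w x ∧ DifferentiableAt ℝ (deriv w) x) ∧
  (∀ x ∈ Set.Ioo a b, -(deriv (deriv w) x) + w x = B x) ∧
  deriv w a = 0 ∧ deriv w b = 0

/-- The branches `q^±(p) = (1−p)/2 · (1 ∓/± √(1 − pχ²))`. -/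
def qminus (χ p : ℝ) : ℝ := (1 - p) / 2 * (1 - Real.sqrt (1 - p * χ^2))

def qplus (χ p : ℝ) : ℝ := (1 - p) / 2 * (1 + Real.sqrt (1 - p * χ^2))

/-- The auxiliary functions `φ₁, φ₂, φ₃` and the constant `p₀`. -/
def phi1 (p : ℝ) : ℝ := (p + 1) / (1 - p)

def phi2 (χ p : ℝ) : ℝ := (1 - p) / (2 * p) * (1 + Real.sqrt (1 - p * χ^2))

def phi3 (χ p : ℝ) : ℝ := (1 - p) / (2 * p) * (1 - Real.sqrt (1 - p * χ^2))

def p0 : ℝ := (2 * Real.sqrt 3 - 3) / 3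


/-- Differentiation under the integral sign over a compact interval. -/
lemma hasDerivAt_param {a b : ℝ} (hab : a ≤ b) {S : Set ℝ} (hS : IsOpen S) {f f' : ℝ → ℝ → ℝ}
    (hf : ContinuousOn (fun p : ℝ × ℝ => f p.1 p.2) (Icc a b ×ˢ S))
    (hf' : ContinuousOn (fun p : ℝ × ℝ => f' p.1 p.2) (Icc a b ×ˢ S))
    (hd : ∀ x ∈ Icc a b, ∀ t ∈ S, HasDerivAt (fun s => f x s) (f' x t) t) {t : ℝ} (ht : t ∈ S) :
    HasDerivAt (fun s => ∫ x in a..b, f x s) (∫ x in a..b, f' x t) t := by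
  obtain ⟨ε, hε, hball⟩ := Metric.nhds_basis_closedBall.mem_iff.1 (hS.mem_nhds ht)
  have hK : IsCompact (Icc a b ×ˢ Metric.closedBall t ε) :=
    isCompact_Icc.prod (isCompact_closedBall t ε)
  obtain ⟨M, hM⟩ := hK.exists_bound_of_continuousOn (hf'.mono (prod_mono_right hball))
  have hsl : ∀ (g : ℝ → ℝ → ℝ), ContinuousOn (fun p : ℝ × ℝ => g p.1 p.2) (Icc a b ×ˢ S) →
      ∀ s ∈ S, ContinuousOn (fun x => g x s) (Icc a b) := by
    intro g hg s hs
    exact hg.comp (f := fun x => (x, s)) (by fun_prop) (fun x hx => ⟨hx, hs⟩)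
  have hms : ∀ (g : ℝ → ℝ → ℝ), ContinuousOn (fun p : ℝ × ℝ => g p.1 p.2) (Icc a b ×ˢ S) →
      ∀ s ∈ S, AEStronglyMeasurable (fun x => g x s) (volume.restrict (uIoc a b)) := by
    intro g hg s hs
    rw [uIoc_of_le hab]
    exact ((hsl g hg s hs).mono Ioc_subset_Icc_self).aestronglyMeasurable measurableSet_Ioc
  refine (intervalIntegral.hasDerivAt_integral_of_dominated_loc_of_deriv_le
    (F := fun s x => f x s) (F' := fun s x => f' x s) (bound := fun _ => M)
    (Metric.ball_mem_nhds t hε) ?_ ?_ ?_ ?_ ?_ ?_).2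
  · filter_upwards [hS.mem_nhds ht] with s hs using hms f hf s hs
  · exact (by simpa [uIcc_of_le hab] using hsl f hf t ht : ContinuousOn _ (uIcc a b)).intervalIntegrable
  · exact hms f' hf' t ht
  · refine Eventually.of_forall fun x hx s hs => ?_
    rw [uIoc_of_le hab] at hx
    exact hM (x, s) ⟨Ioc_subset_Icc_self hx, Metric.ball_subset_closedBall hs⟩
  · exact intervalIntegrable_const
  · refine Eventually.of_forall fun x hx s hs => ?_
    rw [uIoc_of_le hab] at hx
    exact hd x (Ioc_subset_Icc_self hx) s (hball (Metric.ball_subset_closedBall hs))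

/-- Continuity of parameter integrals over compact sets. -/
lemma continuousOn_param {a b c d : ℝ} (hab : a ≤ b) {f : ℝ → ℝ → ℝ}
    (hf : ContinuousOn (fun p : ℝ × ℝ => f p.1 p.2) (Icc a b ×ˢ Icc c d)) :
    ContinuousOn (fun s => ∫ x in a..b, f x s) (Icc c d) := by
  obtain ⟨M, hM⟩ := (isCompact_Icc.prod isCompact_Icc).exists_bound_of_continuousOn hf
  intro t ht
  refine intervalIntegral.continuousWithinAt_of_dominated_interval (bound := fun _ => M) ?_ ?_
    intervalIntegrable_const ?_
  · filter_upwards [self_mem_nhdsWithin] with s hs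
    rw [uIoc_of_le hab]
    refine ContinuousOn.aestronglyMeasurable ?_ measurableSet_Ioc
    exact hf.comp (f := fun x => (x, s)) (by fun_prop)
      (fun x hx => ⟨Ioc_subset_Icc_self hx, hs⟩)
  · filter_upwards [self_mem_nhdsWithin] with s hs
    refine Eventually.of_forall fun x hx => ?_
    rw [uIoc_of_le hab] at hx
    exact hM (x, s) ⟨Ioc_subset_Icc_self hx, hs⟩
  · refine Eventually.of_forall fun x hx => ?_
    rw [uIoc_of_le hab] at hx
    exact (hf (x, t) ⟨Ioc_subset_Icc_self hx, ht⟩).comp (f := fun s => (x, s))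
      (by fun_prop) (fun s hs => ⟨Ioc_subset_Icc_self hx, hs⟩)

/-- Oscillation bound by the integral of a majorant of the derivative. -/
lemma sub_le_integral_of_abs_deriv_le {a b : ℝ} {g g' h : ℝ → ℝ}
    (hg : ∀ x ∈ Icc a b, HasDerivAt g (g' x) x) (hh : ContinuousOn h (Icc a b))
    (hle : ∀ x ∈ Icc a b, |g' x| ≤ h x) {x y : ℝ} (hx : x ∈ Icc a b) (hy : y ∈ Icc a b) :
    g x - g y ≤ ∫ z in a..b, h z := by
  have hab : a ≤ b := hx.1.trans hx.2
  have hint : ∀ c d, c ∈ Icc a b → d ∈ Icc a b → IntervalIntegrable h volume c d := by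
    intro c d hc hd
    exact (hh.mono (uIcc_subset_Icc hc hd)).intervalIntegrable
  have hnn : ∀ z ∈ Icc a b, 0 ≤ h z := fun z hz => (abs_nonneg _).trans (hle z hz)
  have key : ∀ (g g' : ℝ → ℝ), (∀ x ∈ Icc a b, HasDerivAt g (g' x) x) →
      (∀ x ∈ Icc a b, g' x ≤ h x) → ∀ c d, c ∈ Icc a b → d ∈ Icc a b → c ≤ d →
      g d - g c ≤ ∫ z in a..b, h z := by
    intro g g' hg hle c d hc hd hcd
    have hsub : Icc c d ⊆ Icc a b := Icc_subset_Icc hc.1 hd.2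
    have h1 : g d - g c ≤ ∫ z in c..d, h z :=
      intervalIntegral.sub_le_integral_of_hasDeriv_right_of_le hcd
        (fun z hz => (hg z (hsub hz)).continuousAt.continuousWithinAt)
        (fun z hz => (hg z (hsub (Ioo_subset_Icc_self hz))).hasDerivWithinAt)
        ((hh.mono hsub).integrableOn_Icc)
        (fun z hz => hle z (hsub (Ioo_subset_Icc_self hz)))
    have h2 : ∫ z in c..d, h z ≤ ∫ z in a..b, h z := by
      refine intervalIntegral.integral_mono_interval hc.1 hcd hd.2 ?_
        (hint a b (left_mem_Icc.2 hab) (right_mem_Icc.2 hab))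
      refine (ae_restrict_iff' measurableSet_Ioc).2 (Eventually.of_forall fun z hz => ?_)
      exact hnn z (Ioc_subset_Icc_self hz)
    linarith
  rcases le_total y x with hyx | hxy
  · exact key g g' hg (fun z hz => (le_abs_self _).trans (hle z hz)) y x hy hx hyx
  · have := key (fun z => - g z) (fun z => - g' z) (fun z hz => (hg z hz).neg)
      (fun z hz => (neg_le_abs _).trans (hle z hz)) x y hx hy hxy
    linarith

/-- One-dimensional interpolation inequality. -/
lemma interp_bound {a b p m : ℝ} (hab : a < b) (hp : 0 < p) {w w' : ℝ → ℝ}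
    (hw : ∀ x ∈ Icc a b, HasDerivAt w (w' x) x) (hw' : ContinuousOn w' (Icc a b))
    (hpos : ∀ x ∈ Icc a b, 0 < w x) (hm : ∫ x in a..b, w x ≤ m) :
    ∫ x in a..b, w x ^ (p + 2) ≤
      m * (2 * (m / (b - a)) ^ (p + 1)
        + (p + 1) ^ 2 * (m + 1) * ∫ x in a..b, w x ^ (p - 2) * w' x ^ 2) := by
  have hl : 0 < b - a := sub_pos.2 hab
  have hwc : ContinuousOn w (Icc a b) := fun x hx => (hw x hx).continuousAt.continuousWithinAt
  have hrc : ∀ q : ℝ, ContinuousOn (fun x => w x ^ q) (Icc a b) := fun q =>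
    hwc.rpow_const (fun x hx => Or.inl (hpos x hx).ne')
  have hII : ∀ g : ℝ → ℝ, ContinuousOn g (Icc a b) → IntervalIntegrable g volume a b := by
    intro g hg; exact ContinuousOn.intervalIntegrable (by rwa [uIcc_of_le hab.le])
  have hDc : ContinuousOn (fun x => w x ^ (p - 2) * w' x ^ 2) (Icc a b) :=
    (hrc _).mul (hw'.pow 2)
  obtain ⟨x0, hx0, hmin⟩ := isCompact_Icc.exists_isMinOn (nonempty_Icc.2 hab.le) hwc
  obtain ⟨x1, hx1, hmax⟩ := isCompact_Icc.exists_isMaxOn (nonempty_Icc.2 hab.le) hwc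
  have hminle : w x0 ≤ m / (b - a) := by
    rw [le_div_iff₀ hl]
    refine le_trans ?_ hm
    have := intervalIntegral.integral_mono_on hab.le (intervalIntegrable_const (c := w x0) (μ := volume)) (hII w hwc)
      (fun x hx => hmin hx)
    simpa [mul_comm] using this
  have hmpos : 0 < m := by
    have := lt_of_lt_of_le (hpos x0 hx0) hminle
    by_contra hcon
    exact absurd this (not_lt.2 (div_nonpos_of_nonpos_of_nonneg (not_lt.1 hcon) hl.le))
  set D := ∫ x in a..b, w x ^ (p - 2) * w' x ^ 2 with hD
  set P := ∫ x in a..b, w x ^ (p + 2) with hP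
  set Sx := w x1 ^ (p + 1) with hSx
  have hPS : P ≤ m * Sx := by
    have h1 : P ≤ ∫ x in a..b, w x * Sx := by
      refine intervalIntegral.integral_mono_on hab.le (hII _ (hrc _))
        (hII _ (hwc.mul continuousOn_const)) fun x hx => ?_
      have h2 : w x ^ (p + 2) = w x * w x ^ (p + 1) := by
        rw [show p + 2 = 1 + (p + 1) by ring, rpow_add (hpos x hx), rpow_one]
      rw [h2]
      refine mul_le_mul_of_nonneg_left ?_ (hpos x hx).le
      exact rpow_le_rpow (hpos x hx).le (hmax hx) (by linarith)
    rw [intervalIntegral.integral_mul_const] at h1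
    exact h1.trans (mul_le_mul_of_nonneg_right hm (rpow_nonneg (hpos x1 hx1).le _))
  -- the derivative estimate
  set e : ℝ := 1 / (2 * (m + 1)) with he
  have hepos : 0 < e := by positivity
  have hosc : Sx - w x0 ^ (p + 1) ≤
      ∫ x in a..b, (e * w x ^ (p + 2) + (p + 1) ^ 2 / (4 * e) * (w x ^ (p - 2) * w' x ^ 2)) := by
    refine sub_le_integral_of_abs_deriv_le (g := fun x => w x ^ (p + 1))
      (g' := fun x => w' x * (p + 1) * w x ^ (p + 1 - 1)) ?_ ?_ ?_ hx1 hx0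
    · intro x hx
      exact (hw x hx).rpow_const (Or.inl (hpos x hx).ne')
    · exact (continuousOn_const.mul (hrc _)).add (continuousOn_const.mul hDc)
    · intro x hx
      have hwx := hpos x hx
      set y := w x ^ ((p + 2) / 2) with hy
      set z := w x ^ ((p - 2) / 2) with hz
      have e1 : w x ^ (p + 2) = y ^ 2 := by
        rw [hy, ← rpow_natCast, ← rpow_mul hwx.le]; congr 1; push_cast; ring
      have e2 : w x ^ (p - 2) = z ^ 2 := by
        rw [hz, ← rpow_natCast, ← rpow_mul hwx.le]; congr 1; push_cast; ring
      have e3 : w x ^ (p + 1 - 1) = y * z := by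
        rw [hy, hz, ← rpow_add hwx]; congr 1; ring
      have hy0 : 0 < y := rpow_pos_of_pos hwx _
      have hz0 : 0 < z := rpow_pos_of_pos hwx _
      rw [e1, e2, e3, abs_mul, abs_mul, abs_of_pos (show 0 < p + 1 by linarith),
        abs_of_pos (mul_pos hy0 hz0)]
      have hsq : |w' x| ^ 2 = w' x ^ 2 := sq_abs _
      rw [← hsq]
      have hkey : e * y ^ 2 + (p + 1) ^ 2 / (4 * e) * (z ^ 2 * |w' x| ^ 2)
          - |w' x| * (p + 1) * (y * z)
          = (2 * e * y - (p + 1) * (z * |w' x|)) ^ 2 / (4 * e) := by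
        field_simp; ring
      have : 0 ≤ (2 * e * y - (p + 1) * (z * |w' x|)) ^ 2 / (4 * e) := by positivity
      linarith
  rw [intervalIntegral.integral_add ((hII _ (hrc _)).const_mul _)
    ((hII _ hDc).const_mul _), intervalIntegral.integral_const_mul,
    intervalIntegral.integral_const_mul] at hosc
  have h0 : w x0 ^ (p + 1) ≤ (m / (b - a)) ^ (p + 1) :=
    rpow_le_rpow (hpos x0 hx0).le hminle (by linarith)
  have hS0 : 0 ≤ Sx := rpow_nonneg (hpos x1 hx1).le _
  have heP : e * P ≤ Sx / 2 := by
    have : e * P ≤ e * ((m + 1) * Sx) := by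
      refine mul_le_mul_of_nonneg_left (hPS.trans ?_) hepos.le
      nlinarith
    refine this.trans (le_of_eq ?_)
    rw [he]; field_simp
  have heD : (p + 1) ^ 2 / (4 * e) = (p + 1) ^ 2 * (m + 1) / 2 := by
    rw [he]; field_simp; ring
  rw [heD] at hosc
  refine hPS.trans (mul_le_mul_of_nonneg_left ?_ hmpos.le)
  have : 0 ≤ D := intervalIntegral.integral_nonneg hab.le fun x hx =>
    mul_nonneg (rpow_nonneg (hpos x hx).le _) (sq_nonneg _)
  change Sx - w x0 ^ (p + 1) ≤ e * P + (p + 1) ^ 2 * (m + 1) / 2 * D at hosc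
  linarith

/-- Linear ODE comparison. -/
lemma ode_bound {F F' : ℝ → ℝ} {K δ t : ℝ} (hδ : 0 < δ) (ht : 0 ≤ t)
    (hc : ContinuousOn F (Icc 0 t)) (hd : ∀ s ∈ Ioo 0 t, HasDerivAt F (F' s) s)
    (hle : ∀ s ∈ Ioo 0 t, F' s ≤ K - δ * F s) : F t ≤ |F 0| + |K| / δ := by
  have hant : AntitoneOn (fun s => exp (δ * s) * (F s - K / δ)) (Icc 0 t) := by
    have hder : ∀ s ∈ Ioo 0 t, HasDerivAt (fun s => exp (δ * s) * (F s - K / δ))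
        (exp (δ * s) * (δ * 1) * (F s - K / δ) + exp (δ * s) * F' s) s := by
      intro s hs
      exact (((hasDerivAt_id s).const_mul δ).exp).mul ((hd s hs).sub_const _)
    refine antitoneOn_of_deriv_nonpos (convex_Icc 0 t) ?_ ?_ ?_
    · exact (Continuous.continuousOn (by fun_prop)).mul (hc.sub continuousOn_const)
    · rw [interior_Icc]
      exact fun s hs => (hder s hs).differentiableAt.differentiableWithinAt
    · rw [interior_Icc]
      intro s hs
      rw [(hder s hs).deriv]
      have : exp (δ * s) * (δ * 1) * (F s - K / δ) + exp (δ * s) * F' s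
          = exp (δ * s) * (F' s - (K - δ * F s)) := by field_simp; ring
      rw [this]
      exact mul_nonpos_of_nonneg_of_nonpos (exp_pos _).le (by linarith [hle s hs])
  have h := hant (left_mem_Icc.2 ht) (right_mem_Icc.2 ht) ht
  simp only [mul_zero, exp_zero, one_mul] at h
  have he : 1 ≤ exp (δ * t) := one_le_exp (by positivity)
  have hKd : |K / δ| = |K| / δ := by rw [abs_div, abs_of_pos hδ]
  rw [← hKd]
  by_cases hcase : F t ≤ K / δ
  · have := le_abs_self (K / δ); have := abs_nonneg (F 0); linarith
  · push Not at hcase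
    have h2 : F t - K / δ ≤ exp (δ * t) * (F t - K / δ) := by nlinarith
    have h3 : K / δ = K / δ := rfl
    have := le_abs_self (F 0)
    have := abs_nonneg (K / δ)
    linarith

lemma isOpen_It' (Tmax : ℝ≥0∞) : IsOpen (It' Tmax) :=
  (isOpen_lt continuous_const continuous_id).inter
    (isOpen_lt ENNReal.continuous_ofReal continuous_const)

lemma It'_subset_It (Tmax : ℝ≥0∞) : It' Tmax ⊆ It Tmax := fun _ h => ⟨h.1.le, h.2⟩

lemma mem_It'_of_le {Tmax : ℝ≥0∞} {s t : ℝ} (hs : 0 < s) (hst : s ≤ t)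
    (ht : ENNReal.ofReal t < Tmax) : s ∈ It' Tmax :=
  ⟨hs, lt_of_le_of_lt (ENNReal.ofReal_le_ofReal hst) ht⟩

lemma HypB.slice {a b : ℝ} {B : ℝ → ℝ → ℝ} (h : HypB a b B) {t : ℝ} (ht : 0 ≤ t) :
    ContinuousOn (fun x => B x t) (Icc a b) := by
  obtain ⟨-, -, ϑ, hϑ, hK⟩ := h
  obtain ⟨C, hC⟩ := hK (Icc a b ×ˢ {t}) (isCompact_Icc.prod isCompact_singleton)
    (by rintro ⟨x, s⟩ ⟨hx, hs⟩; rw [mem_singleton_iff] at hs; exact ⟨hx, by change s = t at hs; rw [hs]; exact ht⟩)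
  intro x hx
  have hlim : Tendsto (fun y : ℝ => C * dist (y, t) (x, t) ^ ϑ) (𝓝[Icc a b] x) (𝓝 0) := by
    have hcont : Continuous (fun y : ℝ => C * dist (y, t) (x, t) ^ ϑ) := by
      refine continuous_const.mul (Continuous.rpow_const ?_ fun _ => Or.inr hϑ.1.le)
      fun_prop
    have := hcont.tendsto x
    simp only [dist_self, zero_rpow hϑ.1.ne', mul_zero] at this
    exact this.mono_left nhdsWithin_le_nhds
  rw [ContinuousWithinAt, tendsto_iff_dist_tendsto_zero]
  refine squeeze_zero' (Eventually.of_forall fun _ => dist_nonneg) ?_ hlim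
  filter_upwards [self_mem_nhdsWithin] with y hy
  exact hC (y, t) ⟨hy, rfl⟩ (x, t) ⟨hx, rfl⟩

lemma slice_cont {a b : ℝ} {S : Set ℝ} {g : ℝ → ℝ → ℝ}
    (hg : ContinuousOn (fun p : ℝ × ℝ => g p.1 p.2) (Icc a b ×ˢ S)) {t : ℝ} (ht : t ∈ S) :
    ContinuousOn (fun x => g x t) (Icc a b) :=
  hg.comp (f := fun x => (x, t)) (by fun_prop) (fun x hx => ⟨hx, ht⟩)

section Sol

variable {a b χ : ℝ} {B1 B2 : ℝ → ℝ → ℝ} {u0 v0 : ℝ → ℝ} {u v : ℝ → ℝ → ℝ} {Tmax : ℝ≥0∞}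

lemma CrimeSol.mapsTo_v (hsol : CrimeSol a b χ B1 B2 u0 v0 u v Tmax) :
    MapsTo (fun p : ℝ × ℝ => v p.1 p.2) (Icc a b ×ˢ It' Tmax) (Ioi 0) :=
  fun p hp => hsol.v_pos p.1 hp.1 p.2 hp.2

lemma CrimeSol.v_cont' (hsol : CrimeSol a b χ B1 B2 u0 v0 u v Tmax) :
    ContinuousOn (fun p : ℝ × ℝ => v p.1 p.2) (Icc a b ×ˢ It' Tmax) :=
  hsol.v_cont.mono (prod_mono_right (It'_subset_It _))

lemma CrimeSol.u_cont' (hsol : CrimeSol a b χ B1 B2 u0 v0 u v Tmax) :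
    ContinuousOn (fun p : ℝ × ℝ => u p.1 p.2) (Icc a b ×ˢ It' Tmax) :=
  hsol.u_cont.mono (prod_mono_right (It'_subset_It _))

/-- Testing the second equation by `g(v)`. -/
lemma CrimeSol.v_test (hsol : CrimeSol a b χ B1 B2 u0 v0 u v Tmax) (hab : a < b)
    (hB2 : HypB a b B2) {Φ g g' : ℝ → ℝ}
    (hΦ : ∀ y, 0 < y → HasDerivAt Φ (g y) y) (hg : ∀ y, 0 < y → HasDerivAt g (g' y) y)
    (hg' : ContinuousOn g' (Ioi 0)) {t : ℝ} (ht : t ∈ It' Tmax) :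
    HasDerivAt (fun s => ∫ x in a..b, Φ (v x s))
      (∫ x in a..b, (g (v x t) * (u x t * v x t - v x t + B2 x t) - g' (v x t) * pdx v x t ^ 2)) t := by
  have hΦc : ContinuousOn Φ (Ioi 0) := fun y hy => (hΦ y hy).continuousAt.continuousWithinAt
  have hgc : ContinuousOn g (Ioi 0) := fun y hy => (hg y hy).continuousAt.continuousWithinAt
  have hvtc : ContinuousOn (fun p : ℝ × ℝ => pdt v p.1 p.2) (Icc a b ×ˢ It' Tmax) :=
    hsol.v_cont21.snd.snd
  have h1 := hasDerivAt_param (f := fun x s => Φ (v x s)) (f' := fun x s => g (v x s) * pdt v x s)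
    hab.le (isOpen_It' Tmax) (hΦc.comp hsol.v_cont' hsol.mapsTo_v)
    ((hgc.comp hsol.v_cont' hsol.mapsTo_v).mul hvtc)
    (fun x hx s hs => (hΦ _ (hsol.v_pos x hx s hs)).comp s (hsol.v_reg x hx s hs).2.2.hasDerivAt) ht
  convert h1 using 1
  have hII : ∀ g : ℝ → ℝ, ContinuousOn g (Icc a b) → IntervalIntegrable g volume a b := by
    intro g hg; exact ContinuousOn.intervalIntegrable (by rwa [uIcc_of_le hab.le])
  have hvs := slice_cont hsol.v_cont' ht
  have hus := slice_cont hsol.u_cont' ht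
  have hvts := slice_cont hvtc ht
  have hvxs : ContinuousOn (fun x => pdx v x t) (Icc a b) := slice_cont hsol.v_cont21.fst ht
  have hmt : MapsTo (fun x => v x t) (Icc a b) (Ioi 0) := fun x hx => hsol.v_pos x hx t ht
  have hgs : ContinuousOn (fun x => g (v x t)) (Icc a b) := hgc.comp hvs hmt
  have hg's : ContinuousOn (fun x => g' (v x t)) (Icc a b) := hg'.comp hvs hmt
  have hc1 : ContinuousOn (fun x => g (v x t) * pdt v x t) (Icc a b) := hgs.mul hvts
  have hc2 : ContinuousOn (fun x => g (v x t) * (u x t * v x t - v x t + B2 x t)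
      - g' (v x t) * pdx v x t ^ 2) (Icc a b) :=
    (hgs.mul (((hus.mul hvs).sub hvs).add (hB2.slice ht.1.le))).sub (hg's.mul (hvxs.pow 2))
  have h0 : ∫ x in a..b, (g (v x t) * pdt v x t -
      (g (v x t) * (u x t * v x t - v x t + B2 x t) - g' (v x t) * pdx v x t ^ 2)) = 0 := by
    refine (intervalIntegral.integral_eq_sub_of_hasDerivAt_of_le
      (f := fun x => g (v x t) * pdx v x t) hab.le (hgs.mul hvxs) ?_ (hII _ (hc1.sub hc2))).trans (by simp [hsol.v_bc t ht])
    · intro x hx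
      have hx' := Ioo_subset_Icc_self hx
      have hreg := hsol.v_reg x hx' t ht
      have hd1 : HasDerivAt (fun y => v y t) (pdx v x t) x := hreg.1.hasDerivAt
      have hd2 : HasDerivAt (fun y => pdx v y t) (pdx (pdx v) x t) x := hreg.2.1.hasDerivAt
      have hd3 := ((hg _ (hsol.v_pos x hx' t ht)).comp x hd1).mul hd2
      refine hd3.congr_deriv ?_
      simp only [Function.comp, Pi.sub_apply]
      rw [hsol.v_eq x hx t ht]
      ring
  rw [intervalIntegral.integral_sub (hII _ hc1) (hII _ hc2)] at h0
  linarith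

/-- Mass evolution of `u`. -/
lemma CrimeSol.u_mass (hsol : CrimeSol a b χ B1 B2 u0 v0 u v Tmax) (hab : a < b)
    (hB1 : HypB a b B1) {t : ℝ} (ht : t ∈ It' Tmax) :
    HasDerivAt (fun s => ∫ x in a..b, u x s) (∫ x in a..b, (B1 x t - u x t * v x t)) t := by
  have hutc : ContinuousOn (fun p : ℝ × ℝ => pdt u p.1 p.2) (Icc a b ×ˢ It' Tmax) :=
    hsol.u_cont21.snd.snd
  have h1 := hasDerivAt_param (f := u) (f' := pdt u)
    hab.le (isOpen_It' Tmax) hsol.u_cont' hutc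
    (fun x hx s hs => (hsol.u_reg x hx s hs).2.2.hasDerivAt) ht
  convert h1 using 1
  have hII : ∀ g : ℝ → ℝ, ContinuousOn g (Icc a b) → IntervalIntegrable g volume a b := by
    intro g hg; exact ContinuousOn.intervalIntegrable (by rwa [uIcc_of_le hab.le])
  have hvs := slice_cont hsol.v_cont' ht
  have hus := slice_cont hsol.u_cont' ht
  have huts := slice_cont hutc ht
  have huxs : ContinuousOn (fun x => pdx u x t) (Icc a b) := slice_cont hsol.u_cont21.fst ht
  have hvxs : ContinuousOn (fun x => pdx v x t) (Icc a b) := slice_cont hsol.v_cont21.fst ht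
  have hne : ∀ x ∈ Icc a b, v x t ≠ 0 := fun x hx => (hsol.v_pos x hx t ht).ne'
  have hc2 : ContinuousOn (fun x => B1 x t - u x t * v x t) (Icc a b) :=
    (hB1.slice ht.1.le).sub (hus.mul hvs)
  have h0 : ∫ x in a..b, (pdt u x t - (B1 x t - u x t * v x t)) = 0 := by
    refine (intervalIntegral.integral_eq_sub_of_hasDerivAt_of_le
      (f := fun x => pdx u x t - χ * (u x t / v x t * pdx v x t)) hab.le
      (huxs.sub (continuousOn_const.mul ((hus.div hvs hne).mul hvxs))) ?_ (hII _ (huts.sub hc2))).trans (by simp [hsol.v_bc t ht, hsol.u_bc t ht])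
    · intro x hx
      have hx' := Ioo_subset_Icc_self hx
      have hreg := hsol.v_reg x hx' t ht
      have hregu := hsol.u_reg x hx' t ht
      have hd2 : HasDerivAt (fun y => pdx u y t) (pdx (pdx u) x t) x := hregu.2.1.hasDerivAt
      have hd3 : HasDerivAt (fun y => u y t / v y t * pdx v y t)
          (pdx (fun y s => u y s / v y s * pdx v y s) x t) x :=
        DifferentiableAt.hasDerivAt
          (((hregu.1.div hreg.1 (hne x hx')).mul hreg.2.1 :
            DifferentiableAt ℝ (fun y => u y t / v y t * pdx v y t) x))
      refine (hd2.sub (hd3.const_mul χ)).congr_deriv ?_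
      simp only [Pi.sub_apply]
      rw [hsol.u_eq x hx t ht]
      ring
  rw [intervalIntegral.integral_sub (hII _ huts) (hII _ hc2)] at h0
  linarith

/-- Spatio-temporal bound on a window, given a mass bound. -/
lemma CrimeSol.window (hsol : CrimeSol a b χ B1 B2 u0 v0 u v Tmax) (hab : a < b)
    (hB2 : HypB a b B2) {r : ℝ} (hr : r ∈ Ioo (1:ℝ) 3) (m : ℝ) (hm0 : 0 < m) :
    ∃ C : ℝ, 0 < C ∧ ∀ t : ℝ, 0 < t → ENNReal.ofReal (t + tauOf Tmax) < Tmax →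
      (∀ s ∈ Icc t (t + tauOf Tmax), ∫ x in a..b, v x s ≤ m) →
      (∫ s in t..(t + tauOf Tmax), ∫ x in Ioo a b, v x s ^ r) ≤ C := by
  have hl : 0 < b - a := sub_pos.2 hab
  obtain ⟨p, hp0, hp1, hrp⟩ : ∃ p : ℝ, 0 < p ∧ p < 1 ∧ r ≤ p + 2 := by
    refine ⟨max (r - 2) (1 / 2), ?_, ?_, ?_⟩
    · exact lt_of_lt_of_le (by norm_num) (le_max_right _ _)
    · exact max_lt (by linarith [hr.2]) (by norm_num)
    · linarith [le_max_left (r - 2) (1 / 2)]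
  set A : ℝ := (b - a) + m * (2 * (m / (b - a)) ^ (p + 1)) with hA
  set G : ℝ := m * ((p + 1) ^ 2 * (m + 1)) / (1 - p) with hG
  have h1p : 0 < 1 - p := by linarith
  have hA0 : 0 < A := by positivity
  have hG0 : 0 < G := by positivity
  have hII : ∀ g : ℝ → ℝ, ContinuousOn g (Icc a b) → IntervalIntegrable g volume a b := by
    intro g hg; exact ContinuousOn.intervalIntegrable (by rwa [uIcc_of_le hab.le])
  have hτ0 : 0 ≤ tauOf Tmax := ENNReal.toReal_nonneg
  have hτ1 : tauOf Tmax ≤ 1 := by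
    have := ENNReal.toReal_mono ENNReal.one_ne_top (min_le_left 1 (Tmax / 3))
    simpa [tauOf] using this
  set N : ℝ := (b - a) + m with hN
  have hN0 : 0 < N := by positivity
  refine ⟨A + G * N + G / p * N, by positivity, ?_⟩
  intro t ht0 htT hmass
  have hmem : ∀ s ∈ Icc t (t + tauOf Tmax), s ∈ It' Tmax := fun s hs =>
    mem_It'_of_le (ht0.trans_le hs.1) hs.2 htT
  -- the functional ∫ v^p
  set E : ℝ → ℝ := fun s => ∫ x in a..b, v x s ^ p with hE
  set E' : ℝ → ℝ := fun s => ∫ x in a..b, ((p * v x s ^ (p - 1)) * (u x s * v x s - v x s + B2 x s)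
    - (p * ((p - 1) * v x s ^ (p - 1 - 1))) * pdx v x s ^ 2) with hE'
  have hEd : ∀ s ∈ It' Tmax, HasDerivAt E (E' s) s := by
    intro s hs
    refine hsol.v_test hab hB2 (Φ := fun y => y ^ p) (g := fun y => p * y ^ (p - 1))
      (g' := fun y => p * ((p - 1) * y ^ (p - 1 - 1))) ?_ ?_ ?_ hs
    · intro y hy; exact hasDerivAt_rpow_const (Or.inl hy.ne')
    · intro y hy; exact (hasDerivAt_rpow_const (Or.inl hy.ne')).const_mul p
    · refine continuousOn_const.mul (continuousOn_const.mul ?_)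
      exact continuousOn_id.rpow_const fun y hy => Or.inl (ne_of_gt hy)
  set P : ℝ → ℝ := fun s => ∫ x in a..b, v x s ^ r with hP
  have hPd : ∀ s ∈ It' Tmax, ContinuousAt P s := by
    intro s hs
    refine (hsol.v_test hab hB2 (Φ := fun y => y ^ r) (g := fun y => r * y ^ (r - 1))
      (g' := fun y => r * ((r - 1) * y ^ (r - 1 - 1))) ?_ ?_ ?_ hs).continuousAt
    · intro y hy; exact hasDerivAt_rpow_const (Or.inl hy.ne')
    · intro y hy; exact (hasDerivAt_rpow_const (Or.inl hy.ne')).const_mul r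
    · refine continuousOn_const.mul (continuousOn_const.mul ?_)
      exact continuousOn_id.rpow_const fun y hy => Or.inl (ne_of_gt hy)
  have hrc : ∀ s ∈ It' Tmax, ∀ q : ℝ, ContinuousOn (fun x => v x s ^ q) (Icc a b) :=
    fun s hs q => (slice_cont hsol.v_cont' hs).rpow_const
      (fun x hx => Or.inl (hsol.v_pos x hx s hs).ne')
  have hE0 : ∀ s ∈ Icc t (t + tauOf Tmax), 0 ≤ E s := fun s hs =>
    intervalIntegral.integral_nonneg hab.le fun x hx =>
      rpow_nonneg (hsol.v_pos x hx s (hmem s hs)).le _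
  have hEN : ∀ s ∈ Icc t (t + tauOf Tmax), E s ≤ N := by
    intro s hs
    have hs' := hmem s hs
    have hvs := slice_cont hsol.v_cont' hs'
    have h1 : E s ≤ ∫ x in a..b, (1 + v x s) := by
      refine intervalIntegral.integral_mono_on hab.le (hII _ (hrc s hs' p))
        (hII _ (continuousOn_const.add hvs)) fun x hx => ?_
      have hv := hsol.v_pos x hx s hs'
      rcases le_total (v x s) 1 with h | h
      · have := rpow_le_one hv.le h hp0.le; linarith
      · have := rpow_le_rpow_of_exponent_le h hp1.le
        rw [rpow_one] at this; linarith
    rw [intervalIntegral.integral_add intervalIntegrable_const (hII _ hvs)] at h1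
    simp only [intervalIntegral.integral_const, smul_eq_mul, mul_one] at h1
    have := hmass s hs
    linarith
  have hkey : ∀ s ∈ Icc t (t + tauOf Tmax), P s ≤ A + G * N + G / p * E' s := by
    intro s hs
    have hs' := hmem s hs
    have hvs := slice_cont hsol.v_cont' hs'
    have hus := slice_cont hsol.u_cont' hs'
    have hvxs : ContinuousOn (fun x => pdx v x s) (Icc a b) := slice_cont hsol.v_cont21.fst hs'
    have hint := interp_bound (p := p) (m := m) (w := fun x => v x s) (w' := fun x => pdx v x s)
      hab hp0 (fun x hx => (hsol.v_reg x hx s hs').1.hasDerivAt) hvxs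
      (fun x hx => hsol.v_pos x hx s hs') (hmass s hs)
    have hP1 : P s ≤ ∫ x in a..b, (1 + v x s ^ (p + 2)) := by
      refine intervalIntegral.integral_mono_on hab.le (hII _ (hrc s hs' r))
        (hII _ (continuousOn_const.add (hrc s hs' _))) fun x hx => ?_
      have hv := hsol.v_pos x hx s hs'
      have hnn := rpow_nonneg hv.le (p + 2)
      rcases le_total (v x s) 1 with h | h
      · have := rpow_le_one hv.le h (by linarith [hr.1] : 0 ≤ r); linarith
      · have := rpow_le_rpow_of_exponent_le h hrp
        linarith
    rw [intervalIntegral.integral_add intervalIntegrable_const (hII _ (hrc s hs' _))] at hP1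
    simp only [intervalIntegral.integral_const, smul_eq_mul, mul_one] at hP1
    set D := ∫ x in a..b, v x s ^ (p - 2) * pdx v x s ^ 2 with hD
    have hE1 : p * (1 - p) * D - p * E s ≤ E' s := by
      have hcD : ContinuousOn (fun x => v x s ^ (p - 2) * pdx v x s ^ 2) (Icc a b) :=
        (hrc s hs' _).mul (hvxs.pow 2)
      rw [hD, hE, ← intervalIntegral.integral_const_mul, ← intervalIntegral.integral_const_mul,
        ← intervalIntegral.integral_sub ((hII _ hcD).const_mul _) ((hII _ (hrc s hs' _)).const_mul _)]
      refine intervalIntegral.integral_mono_on hab.le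
        (((hII _ hcD).const_mul _).sub ((hII _ (hrc s hs' _)).const_mul _)) (hII _ ?_) ?_
      · exact ((continuousOn_const.mul (hrc s hs' _)).mul (((hus.mul hvs).sub hvs).add
          (hB2.slice hs'.1.le))).sub ((continuousOn_const.mul (continuousOn_const.mul
            (hrc s hs' _))).mul (hvxs.pow 2))
      · intro x hx
        have hv := hsol.v_pos x hx s hs'
        have hu := hsol.u_pos x hx s hs'
        have e1 : v x s ^ p = v x s ^ (p - 1) * v x s := by
          rw [← rpow_add_one hv.ne']; congr 1; ring
        rw [e1, show p - 1 - 1 = p - 2 by ring]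
        have hnn : 0 ≤ p * v x s ^ (p - 1) * (u x s * v x s + B2 x s) :=
          mul_nonneg (mul_nonneg hp0.le (rpow_nonneg hv.le _))
            (add_nonneg (mul_pos hu hv).le (hB2.1 x s))
        nlinarith
    have hGD : m * ((p + 1) ^ 2 * (m + 1) * D) = G / p * (p * (1 - p) * D) := by
      rw [hG]; field_simp
    have hGp : 0 ≤ G / p := by positivity
    have h3 : G / p * (p * (1 - p) * D) ≤ G / p * (E' s + p * E s) :=
      mul_le_mul_of_nonneg_left (by linarith) hGp
    have h4 : G / p * (E' s + p * E s) = G / p * E' s + G * E s := by field_simp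
    have h5 : G * E s ≤ G * N := mul_le_mul_of_nonneg_left (hEN s hs) hG0.le
    change _ ≤ m * (2 * (m / (b - a)) ^ (p + 1) + (p + 1) ^ 2 * (m + 1) * D) at hint
    rw [mul_add, hGD] at hint
    rw [hA]
    linarith
  -- integrate
  have htle : t ≤ t + tauOf Tmax := by linarith
  have hPeq : (∫ s in t..(t + tauOf Tmax), ∫ x in Ioo a b, v x s ^ r)
      = ∫ s in t..(t + tauOf Tmax), P s := by
    refine intervalIntegral.integral_congr fun s _ => ?_
    simp only [hP]
    rw [intervalIntegral.integral_of_le hab.le, integral_Ioc_eq_integral_Ioo]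
  rw [hPeq]
  have hPc : ContinuousOn P (Icc t (t + tauOf Tmax)) := fun s hs =>
    (hPd s (hmem s hs)).continuousWithinAt
  have hfin := intervalIntegral.integral_le_sub_of_hasDeriv_right_of_le
    (g := fun s => (A + G * N) * s + G / p * E s) (g' := fun s => (A + G * N) * 1 + G / p * E' s)
    (φ := P) htle
    ((continuousOn_const.mul continuousOn_id).add (continuousOn_const.mul
      (fun s hs => (hEd s (hmem s hs)).continuousAt.continuousWithinAt)))
    (fun s hs => (((hasDerivAt_id s).const_mul _).add
      ((hEd s (hmem s (Ioo_subset_Icc_self hs))).const_mul _)).hasDerivWithinAt)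
    hPc.integrableOn_Icc
    (fun s hs => by simpa using hkey s (Ioo_subset_Icc_self hs))
  refine hfin.trans ?_
  have hGp : 0 ≤ G / p := by positivity
  have h6 : G / p * E (t + tauOf Tmax) ≤ G / p * N :=
    mul_le_mul_of_nonneg_left (hEN _ (right_mem_Icc.2 htle)) hGp
  have h7 : 0 ≤ G / p * E t := mul_nonneg hGp (hE0 _ (left_mem_Icc.2 htle))
  have h8 : (A + G * N) * tauOf Tmax ≤ (A + G * N) * 1 :=
    mul_le_mul_of_nonneg_left hτ1 (by positivity)
  nlinarith

lemma HypB.integral_bound {B : ℝ → ℝ → ℝ} (h : HypB a b B) (hab : a < b) :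
    ∃ K : ℝ, 0 ≤ K ∧ ∀ t, 0 ≤ t → ∫ x in a..b, B x t ≤ K := by
  obtain ⟨M, hM⟩ := h.2.1
  have hM0 : 0 ≤ M := (h.1 0 0).trans (hM 0 0)
  refine ⟨M * (b - a), mul_nonneg hM0 (sub_pos.2 hab).le, fun t ht => ?_⟩
  have h1 : IntervalIntegrable (fun x => B x t) volume a b :=
    ContinuousOn.intervalIntegrable (by rw [uIcc_of_le hab.le]; exact h.slice ht)
  have := intervalIntegral.integral_mono_on hab.le h1 (intervalIntegrable_const (c := M))
    (fun x _ => hM x t)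
  simpa [mul_comm] using this

lemma Icc_subset_It {t : ℝ} (ht : t ∈ It' Tmax) : Icc 0 t ⊆ It Tmax := fun _ hs =>
  ⟨hs.1, lt_of_le_of_lt (ENNReal.ofReal_le_ofReal hs.2) ht.2⟩

lemma Ioo_subset_It' {t : ℝ} (ht : t ∈ It' Tmax) : Ioo 0 t ⊆ It' Tmax := fun _ hs =>
  mem_It'_of_le hs.1 hs.2.le ht.2

lemma CrimeSol.U_cont (hsol : CrimeSol a b χ B1 B2 u0 v0 u v Tmax) (hab : a < b)
    {t : ℝ} (ht : t ∈ It' Tmax) : ContinuousOn (fun s => ∫ x in a..b, u x s) (Icc 0 t) :=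
  continuousOn_param hab.le (hsol.u_cont.mono (prod_mono_right (Icc_subset_It ht)))

lemma CrimeSol.V_cont (hsol : CrimeSol a b χ B1 B2 u0 v0 u v Tmax) (hab : a < b)
    {t : ℝ} (ht : t ∈ It' Tmax) : ContinuousOn (fun s => ∫ x in a..b, v x s) (Icc 0 t) :=
  continuousOn_param hab.le (hsol.v_cont.mono (prod_mono_right (Icc_subset_It ht)))

lemma CrimeSol.U_nonneg (hsol : CrimeSol a b χ B1 B2 u0 v0 u v Tmax) (hab : a < b)
    {t : ℝ} (ht : t ∈ It' Tmax) : 0 ≤ ∫ x in a..b, u x t :=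
  intervalIntegral.integral_nonneg hab.le fun x hx => (hsol.u_pos x hx t ht).le

lemma CrimeSol.V_nonneg (hsol : CrimeSol a b χ B1 B2 u0 v0 u v Tmax) (hab : a < b)
    {t : ℝ} (ht : t ∈ It' Tmax) : 0 ≤ ∫ x in a..b, v x t :=
  intervalIntegral.integral_nonneg hab.le fun x hx => (hsol.v_pos x hx t ht).le

/-- Evolution of the total mass. -/
lemma CrimeSol.W_deriv (hsol : CrimeSol a b χ B1 B2 u0 v0 u v Tmax) (hab : a < b)
    (hB1 : HypB a b B1) (hB2 : HypB a b B2) {t : ℝ} (ht : t ∈ It' Tmax) :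
    HasDerivAt (fun s => (∫ x in a..b, u x s) + ∫ x in a..b, v x s)
      ((∫ x in a..b, B1 x t) + (∫ x in a..b, B2 x t) - ∫ x in a..b, v x t) t := by
  have h1 := hsol.u_mass hab hB1 ht
  have h2 := hsol.v_test hab hB2 (Φ := fun y => y) (g := fun _ => 1) (g' := fun _ => 0)
    (fun y _ => hasDerivAt_id y) (fun y _ => hasDerivAt_const y 1) continuousOn_const ht
  have hII : ∀ g : ℝ → ℝ, ContinuousOn g (Icc a b) → IntervalIntegrable g volume a b := by
    intro g hg; exact ContinuousOn.intervalIntegrable (by rwa [uIcc_of_le hab.le])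
  have hvs := slice_cont hsol.v_cont' ht
  have hus := slice_cont hsol.u_cont' ht
  have huv : IntervalIntegrable (fun x => u x t * v x t) volume a b := hII _ (hus.mul hvs)
  have hb1 := hII _ (hB1.slice ht.1.le)
  have hb2 := hII _ (hB2.slice ht.1.le)
  refine (h1.add h2).congr_deriv ?_
  simp only [one_mul, zero_mul, sub_zero]
  rw [intervalIntegral.integral_sub hb1 huv, intervalIntegral.integral_add (huv.sub (hII _ hvs)) hb2,
    intervalIntegral.integral_sub huv (hII _ hvs)]
  ring

lemma CrimeSol.mass_T (hsol : CrimeSol a b χ B1 B2 u0 v0 u v Tmax) (hab : a < b)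
    (hB1 : HypB a b B1) (hB2 : HypB a b B2) (T : ℝ) :
    ∃ m : ℝ, 0 < m ∧ ∀ t ∈ It' Tmax, t ≤ T → ∫ x in a..b, v x t ≤ m := by
  obtain ⟨K1, hK10, hK1⟩ := hB1.integral_bound hab
  obtain ⟨K2, hK20, hK2⟩ := hB2.integral_bound hab
  refine ⟨|(∫ x in a..b, u x 0) + ∫ x in a..b, v x 0| + (K1 + K2) * |T| + 1, by positivity, ?_⟩
  intro t ht htT
  have h := intervalIntegral.sub_le_integral_of_hasDeriv_right_of_le
    (g := fun s => (∫ x in a..b, u x s) + ∫ x in a..b, v x s) (φ := fun _ => K1 + K2) ht.1.le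
    ((hsol.U_cont hab ht).add (hsol.V_cont hab ht))
    (fun s hs => (hsol.W_deriv hab hB1 hB2 (Ioo_subset_It' ht hs)).hasDerivWithinAt)
    (continuousOn_const.integrableOn_Icc)
    (fun s hs => by
      have := hsol.V_nonneg hab (Ioo_subset_It' ht hs)
      have := hK1 s hs.1.le
      have := hK2 s hs.1.le
      linarith)
  simp only [intervalIntegral.integral_const, smul_eq_mul, sub_zero] at h
  have hU := hsol.U_nonneg hab ht
  have h2 := le_abs_self ((∫ x in a..b, u x 0) + ∫ x in a..b, v x 0)
  have h3 : t * (K1 + K2) ≤ (K1 + K2) * |T| := by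
    rw [mul_comm]
    exact mul_le_mul_of_nonneg_left (htT.trans (le_abs_self T)) (by positivity)
  linarith

lemma CrimeSol.mass_H1 (hsol : CrimeSol a b χ B1 B2 u0 v0 u v Tmax) (hab : a < b)
    (hB1 : HypB a b B1) (hB2 : HypB a b B2) (hH1 : HypH1 a b B1) :
    ∃ m : ℝ, 0 < m ∧ ∀ t ∈ It' Tmax, ∫ x in a..b, v x t ≤ m := by
  obtain ⟨K1, hK10, hK1⟩ := hB1.integral_bound hab
  obtain ⟨K2, hK20, hK2⟩ := hB2.integral_bound hab
  have hint : IntegrableOn (fun s => ∫ x in a..b, B1 x s) (Ioi 0) := by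
    have h : Integrable (fun p : ℝ × ℝ => B1 p.1 p.2)
        ((volume.restrict (Ioo a b)).prod (volume.restrict (Ioi 0))) := by
      rw [Measure.prod_restrict]; exact hH1
    have h2 := h.integral_prod_right
    refine h2.congr (Eventually.of_forall fun s => ?_)
    simp only [intervalIntegral.integral_of_le hab.le, integral_Ioc_eq_integral_Ioo]
  have hnn : ∀ s, 0 ≤ ∫ x in a..b, B1 x s := fun s =>
    intervalIntegral.integral_nonneg hab.le fun x _ => hB1.1 x s
  set Q : ℝ := ∫ s in Ioi 0, ∫ x in a..b, B1 x s with hQ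
  have hQ0 : 0 ≤ Q := integral_nonneg fun s => hnn s
  set R : ℝ := |∫ x in a..b, u x 0| + Q with hR
  have hU : ∀ t ∈ It' Tmax, ∫ x in a..b, u x t ≤ R := by
    intro t ht
    have h := intervalIntegral.sub_le_integral_of_hasDeriv_right_of_le
      (g := fun s => ∫ x in a..b, u x s) (φ := fun s => ∫ x in a..b, B1 x s) ht.1.le
      (hsol.U_cont hab ht)
      (fun s hs => (hsol.u_mass hab hB1 (Ioo_subset_It' ht hs)).hasDerivWithinAt)
      ((integrableOn_Icc_iff_integrableOn_Ioc).2 (hint.mono_set Ioc_subset_Ioi_self))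
      (fun s hs => by
        have hs' := Ioo_subset_It' ht hs
        have hb : ContinuousOn (fun x => B1 x s) (Icc a b) := hB1.slice hs.1.le
        have huv := (slice_cont hsol.u_cont' hs').mul (slice_cont hsol.v_cont' hs')
        refine intervalIntegral.integral_mono_on hab.le
          (ContinuousOn.intervalIntegrable (by rw [uIcc_of_le hab.le]; exact hb.sub huv))
          (ContinuousOn.intervalIntegrable (by rwa [uIcc_of_le hab.le])) fun x hx => ?_
        have := mul_pos (hsol.u_pos x hx s hs') (hsol.v_pos x hx s hs')
        linarith)
    have h2 : ∫ s in (0:ℝ)..t, ∫ x in a..b, B1 x s ≤ Q := by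
      rw [intervalIntegral.integral_of_le ht.1.le]
      exact setIntegral_mono_set hint (Eventually.of_forall fun s => hnn s)
        (Eventually.of_forall fun s hs => Ioc_subset_Ioi_self hs)
    have h3 := le_abs_self (∫ x in a..b, u x 0)
    linarith
  have hR0 : 0 ≤ R := by positivity
  refine ⟨|(∫ x in a..b, u x 0) + ∫ x in a..b, v x 0| + |R + K1 + K2| / 1 + 1, by positivity, ?_⟩
  intro t ht
  have h := ode_bound (F := fun s => (∫ x in a..b, u x s) + ∫ x in a..b, v x s)
    (K := R + K1 + K2) (δ := 1) (t := t) one_pos ht.1.le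
    ((hsol.U_cont hab ht).add (hsol.V_cont hab ht))
    (fun s hs => hsol.W_deriv hab hB1 hB2 (Ioo_subset_It' ht hs))
    (fun s hs => by
      have := hU s (Ioo_subset_It' ht hs)
      have := hK1 s hs.1.le
      have := hK2 s hs.1.le
      linarith)
  have := hsol.U_nonneg hab ht
  linarith

lemma CrimeSol.mass_H2 (hsol : CrimeSol a b χ B1 B2 u0 v0 u v Tmax) (hab : a < b)
    (hB1 : HypB a b B1) (hB2 : HypB a b B2) (hinit : HypInit a b u0 v0) (hH2 : HypH2 a b B2) :
    ∃ m : ℝ, 0 < m ∧ ∀ t ∈ It' Tmax, ∫ x in a..b, v x t ≤ m := by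
  obtain ⟨K1, hK10, hK1⟩ := hB1.integral_bound hab
  obtain ⟨K2, hK20, hK2⟩ := hB2.integral_bound hab
  obtain ⟨c, hc, hcB⟩ := hH2
  have hl : 0 < b - a := sub_pos.2 hab
  set l := b - a with hldef
  have hII : ∀ g : ℝ → ℝ, ContinuousOn g (Icc a b) → IntervalIntegrable g volume a b := by
    intro g hg; exact ContinuousOn.intervalIntegrable (by rwa [uIcc_of_le hab.le])
  obtain ⟨δ, hδ, hδ1, hδ2, hδ3⟩ : ∃ δ : ℝ, 0 < δ ∧ δ ≤ 1 ∧ δ * l ≤ 1 ∧ δ * l ≤ c := by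
    refine ⟨min 1 (min (1 / l) (c / l)), by positivity, min_le_left _ _, ?_, ?_⟩
    · rw [← le_div_iff₀ hl]; exact (min_le_right _ _).trans (min_le_left _ _)
    · rw [← le_div_iff₀ hl]; exact (min_le_right _ _).trans (min_le_right _ _)
  set F : ℝ → ℝ := fun s => ((∫ x in a..b, u x s) + ∫ x in a..b, v x s)
    - ∫ x in a..b, log (v x s) with hF
  set K : ℝ := K1 + K2 + l + l with hK
  have hposIt : ∀ x ∈ Icc a b, ∀ t ∈ It Tmax, 0 < v x t := by
    intro x hx t ht
    rcases ht.1.eq_or_lt with h | h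
    · rw [← h, hsol.v_init x hx]; exact hinit.2.2.2 x hx
    · exact hsol.v_pos x hx t ⟨h, ht.2⟩
  refine ⟨2 * (|F 0| + |K| / δ) + 1, by positivity, ?_⟩
  intro t ht
  have hFc : ContinuousOn F (Icc 0 t) := by
    refine ((hsol.U_cont hab ht).add (hsol.V_cont hab ht)).sub ?_
    refine continuousOn_param hab.le (f := fun x s => log (v x s)) ?_
    exact (hsol.v_cont.mono (prod_mono_right (Icc_subset_It ht))).log
      (fun q hq => (hposIt q.1 hq.1 q.2 (Icc_subset_It ht hq.2)).ne')
  have hlogd : ∀ s ∈ It' Tmax, HasDerivAt (fun s => ∫ x in a..b, log (v x s))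
      (∫ x in a..b, ((v x s)⁻¹ * (u x s * v x s - v x s + B2 x s)
        - (-((v x s) ^ 2)⁻¹) * pdx v x s ^ 2)) s := by
    intro s hs
    refine hsol.v_test hab hB2 (Φ := log) (g := fun y => y⁻¹) (g' := fun y => -(y ^ 2)⁻¹)
      (fun y hy => hasDerivAt_log hy.ne') (fun y hy => hasDerivAt_inv hy.ne') ?_ hs
    exact ((continuousOn_id.pow 2).inv₀ (fun y hy => pow_ne_zero 2 (ne_of_gt hy))).neg
  have hode := ode_bound (F := F) (K := K) (δ := δ) (t := t) hδ ht.1.le hFc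
    (fun s hs => (hsol.W_deriv hab hB1 hB2 (Ioo_subset_It' ht hs)).sub
      (hlogd s (Ioo_subset_It' ht hs))) (fun s hs => by
    have hs' := Ioo_subset_It' ht hs
    have hvs := slice_cont hsol.v_cont' hs'
    have hus := slice_cont hsol.u_cont' hs'
    have hvxs : ContinuousOn (fun x => pdx v x s) (Icc a b) := slice_cont hsol.v_cont21.fst hs'
    have hbs : ContinuousOn (fun x => B2 x s) (Icc a b) := hB2.slice hs.1.le
    have hvp : ∀ x ∈ Icc a b, 0 < v x s := fun x hx => hsol.v_pos x hx s hs'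
    have hlogc : ContinuousOn (fun x => log (v x s)) (Icc a b) :=
      hvs.log fun x hx => (hvp x hx).ne'
    have hqc : ContinuousOn (fun x => (pdx v x s / v x s) ^ 2) (Icc a b) :=
      (hvxs.div hvs fun x hx => (hvp x hx).ne').pow 2
    have hic : ContinuousOn (fun x => (v x s)⁻¹) (Icc a b) := hvs.inv₀ fun x hx => (hvp x hx).ne'
    obtain ⟨x1, hx1, hmax⟩ := isCompact_Icc.exists_isMaxOn (nonempty_Icc.2 hab.le) hvs
    set y := - log (v x1 s) with hy
    have hey : exp y = (v x1 s)⁻¹ := by rw [hy, exp_neg, exp_log (hvp x1 hx1)]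
    set D := ∫ x in a..b, (pdx v x s / v x s) ^ 2 with hD
    have hD0 : 0 ≤ D := intervalIntegral.integral_nonneg hab.le fun x _ => sq_nonneg _
    -- lower bound for the derivative of ∫ log v
    have hlow : D + (∫ x in a..b, u x s) - l + c * exp y ≤
        ∫ x in a..b, ((v x s)⁻¹ * (u x s * v x s - v x s + B2 x s)
        - (-((v x s) ^ 2)⁻¹) * pdx v x s ^ 2) := by
      have hBc : c * exp y ≤ ∫ x in a..b, B2 x s * exp y := by
        rw [intervalIntegral.integral_mul_const]
        refine mul_le_mul_of_nonneg_right ?_ (exp_pos y).le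
        rw [intervalIntegral.integral_of_le hab.le, integral_Ioc_eq_integral_Ioo]
        exact hcB s hs.1
      have i1 := hII _ hqc
      have i2 := hII _ hus
      have i3 : IntervalIntegrable (fun _ : ℝ => (1:ℝ)) volume a b := intervalIntegrable_const
      have i4 : IntervalIntegrable (fun x => B2 x s * exp y) volume a b := (hII _ hbs).mul_const _
      have hsum : D + (∫ x in a..b, u x s) - l + ∫ x in a..b, B2 x s * exp y
          = ∫ x in a..b, ((pdx v x s / v x s) ^ 2 + u x s - 1 + B2 x s * exp y) := by
        rw [intervalIntegral.integral_add ((i1.add i2).sub i3) i4,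
          intervalIntegral.integral_sub (i1.add i2) i3, intervalIntegral.integral_add i1 i2]
        simp [hD, hldef]
      have hmono : ∫ x in a..b, ((pdx v x s / v x s) ^ 2 + u x s - 1 + B2 x s * exp y) ≤
          ∫ x in a..b, ((v x s)⁻¹ * (u x s * v x s - v x s + B2 x s)
            - (-((v x s) ^ 2)⁻¹) * pdx v x s ^ 2) := by
        refine intervalIntegral.integral_mono_on hab.le (((i1.add i2).sub i3).add i4) (hII _ ?_) ?_
        · refine (hic.mul (((hus.mul hvs).sub hvs).add hbs)).sub (ContinuousOn.mul ?_ (hvxs.pow 2))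
          exact ((hvs.pow 2).inv₀ fun x hx => pow_ne_zero 2 (hvp x hx).ne').neg
        · intro x hx
          have hv := hvp x hx
          have e1 : (v x s)⁻¹ * (u x s * v x s - v x s + B2 x s)
            - (-((v x s) ^ 2)⁻¹) * pdx v x s ^ 2
            = (pdx v x s / v x s) ^ 2 + u x s - 1 + B2 x s * (v x s)⁻¹ := by
            field_simp; ring
          rw [e1, hey]
          have : (v x1 s)⁻¹ ≤ (v x s)⁻¹ := inv_anti₀ hv (hmax hx)
          have := mul_le_mul_of_nonneg_left this (hB2.1 x s)
          linarith
      linarith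
    -- oscillation of log v
    have hosc : ∀ x ∈ Icc a b, - log (v x s) ≤ y + (l + D) / 2 := by
      intro x hx
      have h := sub_le_integral_of_abs_deriv_le (g := fun x => log (v x s))
        (g' := fun x => pdx v x s / v x s) (h := fun x => (1 + (pdx v x s / v x s) ^ 2) / 2)
        (fun z hz => (hsol.v_reg z hz s hs').1.hasDerivAt.log (hvp z hz).ne')
        ((continuousOn_const.add hqc).div_const 2)
        (fun z _ => by
          have h1 := sq_nonneg (|pdx v z s / v z s| - 1)
          have h2 := sq_abs (pdx v z s / v z s)
          nlinarith) hx1 hx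
      rw [intervalIntegral.integral_div, intervalIntegral.integral_add intervalIntegrable_const
        (hII _ hqc)] at h
      simp only [intervalIntegral.integral_const, smul_eq_mul, mul_one] at h
      linarith
    have hlogint : - ∫ x in a..b, log (v x s) ≤ l * (y + (l + D) / 2) := by
      have h := intervalIntegral.integral_mono_on hab.le (hII _ hlogc.neg)
        (intervalIntegrable_const (c := y + (l + D) / 2)) hosc
      have h' : ∫ x in a..b, - log (v x s) ≤ l * (y + (l + D) / 2) := by
        refine h.trans (le_of_eq ?_)
        rw [intervalIntegral.integral_const, smul_eq_mul]
      rwa [intervalIntegral.integral_neg] at h'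
    have hexp : δ * l * y ≤ c * exp y := by
      have h1 := add_one_le_exp y
      have h2 := exp_pos y
      have h3 : δ * l * y ≤ δ * l * exp y :=
        mul_le_mul_of_nonneg_left (by linarith) (by positivity)
      exact h3.trans (mul_le_mul_of_nonneg_right hδ3 h2.le)
    have hlD : δ * l * ((l + D) / 2) ≤ (l + D) / 2 :=
      mul_le_of_le_one_left (by positivity) hδ2
    have hU0 := hsol.U_nonneg hab hs'
    have hV0 := hsol.V_nonneg hab hs'
    have hb1 := hK1 s hs.1.le
    have hb2 := hK2 s hs.1.le
    have hUV : δ * ((∫ x in a..b, u x s) + ∫ x in a..b, v x s) ≤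
        (∫ x in a..b, u x s) + ∫ x in a..b, v x s :=
      mul_le_of_le_one_left (by positivity) hδ1
    have hlog2 := mul_le_mul_of_nonneg_left hlogint hδ.le
    have hFs : δ * F s = δ * ((∫ x in a..b, u x s) + ∫ x in a..b, v x s)
      + δ * (- ∫ x in a..b, log (v x s)) := by rw [hF]; ring
    have hexpand : δ * (l * (y + (l + D) / 2)) = δ * l * y + δ * l * ((l + D) / 2) := by ring
    rw [hFs, hK]
    linarith)
  have hU0 := hsol.U_nonneg hab ht
  have hvs := slice_cont hsol.v_cont' ht
  have hlogc : ContinuousOn (fun x => log (v x t)) (Icc a b) :=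
    hvs.log fun x hx => (hsol.v_pos x hx t ht).ne'
  have hhalf : ∫ x in a..b, log (v x t) ≤ ∫ x in a..b, v x t / 2 := by
    refine intervalIntegral.integral_mono_on hab.le (hII _ hlogc)
      ((hII _ hvs).div_const 2) fun x hx => ?_
    have hv := hsol.v_pos x hx t ht
    have h1 := log_le_sub_one_of_pos (show 0 < v x t / 2 by positivity)
    rw [log_div hv.ne' (by norm_num)] at h1
    have h2 := log_le_sub_one_of_pos (show (0:ℝ) < 2 by norm_num)
    linarith
  rw [intervalIntegral.integral_div] at hhalf
  simp only [hF] at hode ⊢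
  linarith

end Sol

/-- Lemma 3.2 (spatio-temporal bound on `∫∫ v^r` for `r ∈ (1,3)`). -/
theorem space_time_Lr_bound_for_v
    (a b χ : ℝ) (hab : a < b) (hχ : 0 < χ)
    (B1 B2 : ℝ → ℝ → ℝ) (hB1 : HypB a b B1) (hB2 : HypB a b B2)
    (u0 v0 : ℝ → ℝ) (hinit : HypInit a b u0 v0)
    (Tmax : ℝ≥0∞) (hT : 0 < Tmax)
    (u v : ℝ → ℝ → ℝ) (hsol : CrimeSol a b χ B1 B2 u0 v0 u v Tmax)
    (r : ℝ) (hr : r ∈ Set.Ioo (1:ℝ) 3) :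
    (∀ T : ℝ, 0 < T → ∃ C : ℝ, 0 < C ∧
      ∀ t : ℝ, 0 < t →
        ENNReal.ofReal (t + tauOf Tmax) < min (ENNReal.ofReal T) Tmax →
        (∫ s in t..(t + tauOf Tmax), ∫ x in Set.Ioo a b, v x s ^ r) ≤ C) ∧
    ((HypH1 a b B1 ∨ HypH2 a b B2) → ∃ C : ℝ, 0 < C ∧
      ∀ t : ℝ, 0 < t → ENNReal.ofReal (t + tauOf Tmax) < Tmax →
        (∫ s in t..(t + tauOf Tmax), ∫ x in Set.Ioo a b, v x s ^ r) ≤ C) := by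
  have hτ0 : 0 ≤ tauOf Tmax := ENNReal.toReal_nonneg
  constructor
  · intro T hT0
    obtain ⟨m, hm, hmass⟩ := hsol.mass_T hab hB1 hB2 T
    obtain ⟨C, hC, hw⟩ := hsol.window hab hB2 hr m hm
    refine ⟨C, hC, fun t ht htT => hw t ht (htT.trans_le (min_le_right _ _)) fun s hs => ?_⟩
    have h1 : t + tauOf Tmax < T := (ENNReal.ofReal_lt_ofReal_iff hT0).1
      (htT.trans_le (min_le_left _ _))
    exact hmass s (mem_It'_of_le (ht.trans_le hs.1) hs.2 (htT.trans_le (min_le_right _ _)))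
      (hs.2.trans h1.le)
  · intro hH
    obtain ⟨m, hm, hmass⟩ : ∃ m : ℝ, 0 < m ∧ ∀ t ∈ It' Tmax, ∫ x in a..b, v x t ≤ m := by
      rcases hH with h | h
      · exact hsol.mass_H1 hab hB1 hB2 h
      · exact hsol.mass_H2 hab hB1 hB2 hinit h
    obtain ⟨C, hC, hw⟩ := hsol.window hab hB2 hr m hm
    exact ⟨C, hC, fun t ht htT => hw t ht htT fun s hs =>
      hmass s (mem_It'_of_le (ht.trans_le hs.1) hs.2 htT)⟩
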